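/- arXiv:2307.06921 — 8 statements merged into one kernel-verified Lean document; each statement's English description precedes it below -/
import Mathlib

section
/- Poly-exponential closed forms for twn-updates (Lemma 9). Let η : Fin d → MvPolynomial (Fin d) ℂ be a twn-update, i.e., for every i : Fin d there are c_i : ℂ and p_i : MvPolynomial (Fin d) ℂ whose variables are all strictly below i (p_i.vars ⊆ {j : Fin d | j < i}) such that η i = MvPolynomial.C c_i * MvPolynomial.X i + p_i. Then η admits a poly-exponential closed form: there exists n₀ : ℕ such that for every i : Fin d there are k : ℕ, α : Fin k → MvPolynomial (Fin d) ℂ, a : Fin k → ℕ, and b : Fin k → ℂ with, for all σ : Fin d → ℂ and all n ≥ n₀, MvPolynomial.eval σ ((MvPolynomial.bind₁ η)^[n] (MvPolynomial.X i)) = Σ_j (MvPolynomial.eval σ (α j)) * (n : ℂ)^(a j) * (b j)^n. -/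
open MvPolynomial

section PolyExp

open Filter

variable {K R : Type*} [Field K] [CommRing R] [Algebra K R]

/-- The sequence `n ↦ n ^ a * b ^ n`. -/
def polyExpTerm (R : Type*) [CommRing R] [Algebra K R] (a : ℕ) (b : K) : ℕ → R :=
  fun n => (n : R) ^ a * algebraMap K R b ^ n

variable (K R) in
/-- The `R`-linear combinations of the sequences `n ↦ n ^ a * b ^ n` with `b ≠ 0`. -/
def polyExp : Submodule R (ℕ → R) :=
  Submodule.span R {f | ∃ (a : ℕ) (b : K), b ≠ 0 ∧ f = polyExpTerm R a b}

theorem polyExpTerm_mem_polyExp (a : ℕ) {b : K} (hb : b ≠ 0) :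
    polyExpTerm R a b ∈ polyExp K R :=
  Submodule.subset_span ⟨a, b, hb, rfl⟩

theorem polyExpTerm_mul (a a' : ℕ) (b b' : K) :
    polyExpTerm R a b * polyExpTerm R a' b' = polyExpTerm R (a + a') (b * b') := by
  funext n
  simp only [polyExpTerm, Pi.mul_apply, map_mul, mul_pow, pow_add]
  ring

theorem one_mem_polyExp : (1 : ℕ → R) ∈ polyExp K R := by
  convert polyExpTerm_mem_polyExp (R := R) 0 (one_ne_zero : (1 : K) ≠ 0) using 1
  funext n
  simp [polyExpTerm]

theorem mul_mem_polyExp {f g : ℕ → R} (hf : f ∈ polyExp K R) (hg : g ∈ polyExp K R) :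
    f * g ∈ polyExp K R := by
  induction hf, hg using Submodule.span_induction₂ with
  | mem_mem f g hf hg =>
    obtain ⟨a, b, hb, rfl⟩ := hf
    obtain ⟨a', b', hb', rfl⟩ := hg
    rw [polyExpTerm_mul]
    exact polyExpTerm_mem_polyExp _ (mul_ne_zero hb hb')
  | zero_left => simp
  | zero_right => simp
  | add_left _ _ _ _ _ _ h₁ h₂ => simpa only [add_mul] using add_mem h₁ h₂
  | add_right _ _ _ _ _ _ h₁ h₂ => simpa only [mul_add] using add_mem h₁ h₂
  | smul_left r _ _ _ _ h => simpa only [smul_mul_assoc] using Submodule.smul_mem _ r h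
  | smul_right r _ _ _ _ h => simpa only [mul_smul_comm] using Submodule.smul_mem _ r h

theorem aeval_mem_polyExp {ι : Type*} {g : ι → ℕ → R} (hg : ∀ j, g j ∈ polyExp K R)
    (p : MvPolynomial ι K) : aeval g p ∈ polyExp K R := by
  induction p using MvPolynomial.induction_on with
  | C k =>
    have h := Submodule.smul_mem _ (algebraMap K R k) (one_mem_polyExp (K := K) (R := R))
    rwa [algebraMap_smul, ← Algebra.algebraMap_eq_smul_one, ← aeval_C g] at h
  | add p q hp hq => simpa only [map_add] using add_mem hp hq
  | mul_X p j hp => simpa only [map_mul, aeval_X] using mul_mem_polyExp hp (hg j)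

variable (R) in
/-- The operator `f ↦ (n ↦ f (n + 1) - c * f n)`. -/
def shiftSub (c : K) : (ℕ → R) →ₗ[R] (ℕ → R) :=
  LinearMap.funLeft R R (· + 1) - algebraMap K R c • LinearMap.id

theorem shiftSub_apply (c : K) (f : ℕ → R) (n : ℕ) :
    shiftSub R c f n = f (n + 1) - algebraMap K R c * f n := rfl

theorem shiftSub_polyExpTerm (c : K) (a : ℕ) (b : K) :
    shiftSub R c (polyExpTerm R a b) = algebraMap K R (b - c) • polyExpTerm R a b +
      ∑ m ∈ Finset.range a, (algebraMap K R b * (a.choose m : R)) • polyExpTerm R m b := by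
  funext n
  have h : ((n : R) + 1) ^ a = (n : R) ^ a + ∑ m ∈ Finset.range a, (n : R) ^ m * a.choose m := by
    simp [add_pow, Finset.sum_range_succ, add_comm]
  simp only [shiftSub_apply, polyExpTerm, Pi.add_apply, Finset.sum_apply, Pi.smul_apply,
    smul_eq_mul, Nat.cast_add, Nat.cast_one, h, map_sub, pow_succ, add_mul, Finset.sum_mul]
  rw [Finset.sum_congr rfl fun m _ => show
    (n : R) ^ m * (a.choose m : R) * (algebraMap K R b ^ n * algebraMap K R b) =
      algebraMap K R b * (a.choose m : R) * ((n : R) ^ m * algebraMap K R b ^ n) by ring]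
  ring

theorem polyExpTerm_mem_map_shiftSub [CharZero K] (c : K) (a : ℕ) {b : K} (hb : b ≠ 0) :
    polyExpTerm R a b ∈ (polyExp K R).map (shiftSub R c) := by
  have cancel {u : K} (hu : u ≠ 0) {f : ℕ → R} {M : Submodule R (ℕ → R)}
      (h : algebraMap K R u • f ∈ M) : f ∈ M := by
    have := M.smul_mem (algebraMap K R u⁻¹) h
    rwa [smul_smul, ← map_mul, inv_mul_cancel₀ hu, map_one, one_smul] at this
  induction a using Nat.strong_induction_on with
  | _ a ih =>
    have hsum (r : ℕ → R) : ∑ m ∈ Finset.range a, r m • polyExpTerm R m b ∈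
        (polyExp K R).map (shiftSub R c) :=
      sum_mem fun m hm => Submodule.smul_mem _ _ (ih m (Finset.mem_range.1 hm))
    by_cases hbc : b = c
    · subst hbc
      have h := Submodule.mem_map_of_mem (f := shiftSub R b)
        (polyExpTerm_mem_polyExp (R := R) (a + 1) hb)
      rw [shiftSub_polyExpTerm, sub_self, map_zero, zero_smul, zero_add,
        Finset.sum_range_succ, Submodule.add_mem_iff_right _ (hsum _)] at h
      refine cancel (u := b * (a + 1 : ℕ)) (mul_ne_zero hb (Nat.cast_ne_zero.2 a.succ_ne_zero)) ?_
      simpa [Nat.choose_succ_self_right] using h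
    · have h := Submodule.mem_map_of_mem (f := shiftSub R c)
        (polyExpTerm_mem_polyExp (R := R) a hb)
      rw [shiftSub_polyExpTerm, Submodule.add_mem_iff_left _ (hsum _)] at h
      exact cancel (sub_ne_zero.2 hbc) h

theorem polyExp_le_map_shiftSub [CharZero K] (c : K) :
    polyExp K R ≤ (polyExp K R).map (shiftSub R c) := by
  refine Submodule.span_le.2 ?_
  rintro _ ⟨a, b, hb, rfl⟩
  exact polyExpTerm_mem_map_shiftSub c a hb

theorem exists_polyExp_eventuallyEq_of_geometric {c : K} {h : ℕ → R}
    (hh : ∀ᶠ n in atTop, h (n + 1) = algebraMap K R c * h n) :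
    ∃ g ∈ polyExp K R, h =ᶠ[atTop] g := by
  obtain ⟨N, hN⟩ := eventually_atTop.1 hh
  have hpow (m : ℕ) : h (N + m) = algebraMap K R c ^ m * h N := by
    induction m with
    | zero => simp
    | succ m ih => rw [← add_assoc, hN _ (by omega), ih]; ring
  by_cases hc : c = 0
  · refine ⟨0, zero_mem _, eventually_atTop.2 ⟨N + 1, fun n hn => ?_⟩⟩
    obtain ⟨m, rfl⟩ := Nat.exists_eq_add_of_le hn
    rw [add_assoc, hpow, hc]
    simp
  · refine ⟨(algebraMap K R (c⁻¹ ^ N) * h N) • polyExpTerm R 0 c,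
      Submodule.smul_mem _ _ (polyExpTerm_mem_polyExp 0 hc), eventually_atTop.2 ⟨N, fun n hn => ?_⟩⟩
    obtain ⟨m, rfl⟩ := Nat.exists_eq_add_of_le hn
    have hcN : algebraMap K R (c⁻¹ ^ N) * algebraMap K R c ^ N = 1 := by
      rw [← map_pow, ← map_mul, ← mul_pow, inv_mul_cancel₀ hc, one_pow, map_one]
    simp only [hpow, polyExpTerm, Pi.smul_apply, smul_eq_mul, pow_zero, one_mul, pow_add]
    linear_combination (-(algebraMap K R c ^ m * h N)) * hcN

theorem exists_polyExp_eventuallyEq_of_recurrence [CharZero K] {c : K} {x q : ℕ → R}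
    (hq : q ∈ polyExp K R)
    (hx : ∀ᶠ n in atTop, x (n + 1) = algebraMap K R c * x n + q n) :
    ∃ g ∈ polyExp K R, x =ᶠ[atTop] g := by
  obtain ⟨f, hf, rfl⟩ := polyExp_le_map_shiftSub c hq
  obtain ⟨g, hg, hxg⟩ := exists_polyExp_eventuallyEq_of_geometric (c := c) (h := x - f) <| by
    filter_upwards [hx] with n hn
    rw [Pi.sub_apply, Pi.sub_apply, hn, shiftSub_apply]
    ring
  refine ⟨g + f, add_mem hg hf, ?_⟩
  filter_upwards [hxg] with n hn
  rw [Pi.add_apply, ← hn, Pi.sub_apply, sub_add_cancel]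

theorem exists_sum_of_mem_polyExp {f : ℕ → R} (hf : f ∈ polyExp K R) :
    ∃ (k : ℕ) (α : Fin k → R) (a : Fin k → ℕ) (b : Fin k → K),
      ∀ n, f n = ∑ j, α j * (n : R) ^ a j * algebraMap K R (b j) ^ n := by
  obtain ⟨k, α, t, rfl⟩ := Submodule.mem_span_set'.1 hf
  choose a b _ ht using fun j => (t j).2
  refine ⟨k, α, a, b, fun n => ?_⟩
  simp [ht, polyExpTerm, mul_assoc]

end PolyExp

theorem iterate_bind₁_eq_aeval {σ A : Type*} [CommRing A] (η : σ → MvPolynomial σ A) (n : ℕ)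
    (p : MvPolynomial σ A) :
    (bind₁ η)^[n] p = aeval (fun j => (bind₁ η)^[n] (X j)) p := by
  rw [← AlgHom.coe_pow]
  exact DFunLike.congr_fun (aeval_unique _) p

/-- For a twn-update, the iterates of each variable eventually agree with a poly-exponential
sequence. -/
theorem exists_polyExp_eventuallyEq_iterate {d : ℕ} {K : Type*} [Field K] [CharZero K]
    (η : Fin d → MvPolynomial (Fin d) K)
    (htwn : ∀ i : Fin d, ∃ (c : K) (p : MvPolynomial (Fin d) K),
      (∀ j ∈ p.vars, j < i) ∧ η i = C c * X i + p) (i : Fin d) :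
    ∃ g ∈ polyExp K (MvPolynomial (Fin d) K),
      (fun n => (bind₁ η)^[n] (X i)) =ᶠ[Filter.atTop] g := by
  induction i using WellFoundedLT.induction with
  | _ i ih =>
    obtain ⟨c, p, hp, hη⟩ := htwn i
    have ih' (j : Fin d) : ∃ g ∈ polyExp K (MvPolynomial (Fin d) K),
        j < i → (fun n => (bind₁ η)^[n] (X j)) =ᶠ[Filter.atTop] g := by
      by_cases hj : j < i
      · obtain ⟨g, hg, h⟩ := ih j hj
        exact ⟨g, hg, fun _ => h⟩
      · exact ⟨0, zero_mem _, fun h => absurd h hj⟩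
    choose g hg hgX using ih'
    refine exists_polyExp_eventuallyEq_of_recurrence (c := c) (aeval_mem_polyExp hg p) ?_
    have hall : ∀ᶠ n in Filter.atTop, ∀ j, j < i → (bind₁ η)^[n] (X j) = g j n :=
      Filter.eventually_all.2 fun j => Filter.eventually_imp_distrib_left.2 (hgX j)
    filter_upwards [hall] with n hn
    have hpn : (bind₁ η)^[n] p = aeval g p n := by
      rw [iterate_bind₁_eq_aeval]
      have hcomp : aeval g p n = aeval (fun j => g j n) p :=
        DFunLike.congr_fun (comp_aeval g (Pi.evalAlgHom K (fun _ => MvPolynomial (Fin d) K) n)) p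
      rw [hcomp]
      exact eval₂Hom_congr' rfl (fun j hj _ => hn j (hp j hj)) rfl
    rw [Function.iterate_succ_apply, bind₁_X_right, hη, ← hpn, ← AlgHom.coe_pow, map_add, map_mul,
      ← algebraMap_eq, AlgHom.commutes]

/-- Lemma 9: every twn-update admits a poly-exponential closed form. -/
theorem twn_update_has_polyExp_closed_form
    {d : ℕ} (η : Fin d → MvPolynomial (Fin d) ℂ)
    (htwn : ∀ i : Fin d, ∃ (c : ℂ) (p : MvPolynomial (Fin d) ℂ),
      (∀ j ∈ p.vars, j < i) ∧
      η i = MvPolynomial.C c * MvPolynomial.X i + p) :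
    ∃ n₀ : ℕ, ∀ i : Fin d,
      ∃ (k : ℕ) (α : Fin k → MvPolynomial (Fin d) ℂ) (a : Fin k → ℕ) (b : Fin k → ℂ),
        ∀ (σ : Fin d → ℂ) (n : ℕ), n₀ ≤ n →
          MvPolynomial.eval σ ((MvPolynomial.bind₁ η)^[n] (MvPolynomial.X i)) =
            ∑ j, MvPolynomial.eval σ (α j) * (n : ℂ) ^ (a j) * (b j) ^ n := by
  choose g hg hgX using exists_polyExp_eventuallyEq_iterate η htwn
  obtain ⟨n₀, hn₀⟩ := Filter.eventually_atTop.1 (Filter.eventually_all.2 hgX)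
  refine ⟨n₀, fun i => ?_⟩
  obtain ⟨k, α, a, b, h⟩ := exists_sum_of_mem_polyExp (hg i)
  refine ⟨k, α, a, b, fun σ n hn => ?_⟩
  rw [show (bind₁ η)^[n] (X i) = g i n from hn₀ n hn i, h]
  simp [algebraMap_eq]
end

section
/- Chaining and runtime complexity. Let (φ, f) be a semantic loop on a state space S with runtime complexity rc, and let p : ℕ with p ≥ 1. Define the chained loop L_p on S by the guard φ_p σ := ∀ i < p, φ (f^[i] σ) and the update f^[p], with runtime complexity rc_p σ = sInf {(k : ℕ∞) | k : ℕ, ¬ φ_p ((f^[p])^[k] σ)}. Then for every σ : S, (p : ℕ∞) * rc_p σ ≤ rc σ and rc σ ≤ (p : ℕ∞) * rc_p σ + (p - 1). In particular, rc σ = ⊤ if and only if rc_p σ = ⊤ (chaining does not change the termination behavior). -/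
/-- Chaining and runtime complexity: performing `p` iterations of a loop in a
single step divides the runtime complexity by `p` (up to `p - 1`), and in
particular chaining does not change the termination behavior. -/
theorem chaining_runtime_complexity
    {S : Type*} (φ : S → Prop) (f : S → S)
    (rc : S → ℕ∞)
    (hrc : ∀ σ : S, rc σ = sInf {N : ℕ∞ | ∃ n : ℕ, N = (n : ℕ∞) ∧ ¬ φ (f^[n] σ)})
    (p : ℕ) (hp : 1 ≤ p)
    (rcp : S → ℕ∞)
    (hrcp : ∀ σ : S, rcp σ =
      sInf {N : ℕ∞ | ∃ k : ℕ, N = (k : ℕ∞) ∧ ¬ (∀ i < p, φ (f^[i] ((f^[p])^[k] σ)))}) :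
    ∀ σ : S,
      (p : ℕ∞) * rcp σ ≤ rc σ ∧
      rc σ ≤ (p : ℕ∞) * rcp σ + ((p - 1 : ℕ) : ℕ∞) ∧
      (rc σ = ⊤ ↔ rcp σ = ⊤) := by
  intro σ
  have iterate_chained (i k : ℕ) : f^[i] ((f^[p])^[k] σ) = f^[i + p * k] σ := by
    rw [← Function.iterate_mul, ← Function.iterate_add_apply]
  have lower : (p : ℕ∞) * rcp σ ≤ rc σ := by
    rw [hrc]
    refine le_sInf ?_
    rintro _ ⟨n, rfl, hn⟩
    have rcp_le : rcp σ ≤ ((n / p : ℕ) : ℕ∞) := by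
      rw [hrcp]
      refine sInf_le ⟨n / p, rfl, fun h => hn ?_⟩
      simpa only [iterate_chained, Nat.mod_add_div] using h (n % p) (Nat.mod_lt n hp)
    calc (p : ℕ∞) * rcp σ ≤ (p : ℕ∞) * ((n / p : ℕ) : ℕ∞) := by gcongr
      _ ≤ n := by exact_mod_cast Nat.mul_div_le n p
  have upper : rc σ ≤ (p : ℕ∞) * rcp σ + ((p - 1 : ℕ) : ℕ∞) := by
    rcases Set.eq_empty_or_nonempty
      {N : ℕ∞ | ∃ k : ℕ, N = (k : ℕ∞) ∧ ¬ (∀ i < p, φ (f^[i] ((f^[p])^[k] σ)))} with he | hne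
    · have htop : rcp σ = ⊤ := by rw [hrcp, he, sInf_empty]
      rw [htop, ENat.mul_top (by exact_mod_cast (by omega : p ≠ 0)), top_add]
      exact le_top
    · obtain ⟨k, hk, hexit⟩ := csInf_mem hne
      rw [← hrcp] at hk
      push Not at hexit
      obtain ⟨i, hi, hφ⟩ := hexit
      rw [iterate_chained] at hφ
      have rc_le : rc σ ≤ ((i + p * k : ℕ) : ℕ∞) := by
        rw [hrc]
        exact sInf_le ⟨_, rfl, hφ⟩
      rw [hk]
      refine rc_le.trans ?_
      exact_mod_cast (by omega : i + p * k ≤ p * k + (p - 1))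
  refine ⟨lower, upper, fun h => ?_, fun h => ?_⟩
  · by_contra hfin
    lift rcp σ to ℕ using hfin with k
    rw [h, top_le_iff] at upper
    exact absurd upper (by exact_mod_cast ENat.natCast_ne_top (p * k + (p - 1)))
  · rwa [h, ENat.mul_top (by exact_mod_cast (by omega : p ≠ 0)), top_le_iff] at lower
end

section
/- Runtime transfer through chaining and automorphisms (Lemma 12 (c),(d), semantic form). Let (φ, f) be a semantic loop on a state space S with runtime complexity rc, let p : ℕ with p ≥ 1, let T be a type and θ : T ≃ S a bijection. Define the transformed loop L_t on T by guard ψ τ := ∀ i < p, φ (f^[i] (θ τ)) and update g τ := θ.symm (f^[p] (θ τ)), with runtime complexity rc_t τ = sInf {(k : ℕ∞) | k : ℕ, ¬ ψ (g^[k] τ)}. Then for every σ : S, (p : ℕ∞) * rc_t (θ.symm σ) ≤ rc σ and rc σ ≤ (p : ℕ∞) * rc_t (θ.symm σ) + (p - 1). In particular, rc σ = ⊤ iff rc_t (θ.symm σ) = ⊤, and if r : T → ℕ satisfies (r τ : ℕ∞) ≥ rc_t τ for all τ : T, then (p * r (θ.symm σ) + p - 1 : ℕ∞) ≥ rc σ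 for all σ : S. -/
theorem apply_iterate_of_chained_conj {S T : Type*} {f : S → S} {p : ℕ} {θ : T ≃ S} {g : T → T}
    (hg : ∀ τ : T, g τ = θ.symm (f^[p] (θ τ))) (k : ℕ) (τ : T) :
    θ (g^[k] τ) = f^[p * k] (θ τ) := by
  have h : Function.Semiconj θ g f^[p] := fun τ => by simp [hg]
  rw [Function.iterate_mul]
  exact h.iterate_right k τ

/-- Lemma 12 (c),(d), semantic form: runtime transfer through chaining and
automorphisms. -/
theorem runtime_transfer_chaining_automorphism
    {S T : Type*} (φ : S → Prop) (f : S → S)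
    (rc : S → ℕ∞)
    (hrc : ∀ σ : S, rc σ = sInf {N : ℕ∞ | ∃ n : ℕ, N = (n : ℕ∞) ∧ ¬ φ (f^[n] σ)})
    (p : ℕ) (hp : 1 ≤ p)
    (θ : T ≃ S)
    (g : T → T) (hg : ∀ τ : T, g τ = θ.symm (f^[p] (θ τ)))
    (rct : T → ℕ∞)
    (hrct : ∀ τ : T, rct τ =
      sInf {N : ℕ∞ | ∃ k : ℕ, N = (k : ℕ∞) ∧ ¬ (∀ i < p, φ (f^[i] (θ (g^[k] τ))))}) :
    (∀ σ : S,
      (p : ℕ∞) * rct (θ.symm σ) ≤ rc σ ∧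
      rc σ ≤ (p : ℕ∞) * rct (θ.symm σ) + ((p - 1 : ℕ) : ℕ∞) ∧
      (rc σ = ⊤ ↔ rct (θ.symm σ) = ⊤)) ∧
    (∀ r : T → ℕ, (∀ τ : T, rct τ ≤ ((r τ : ℕ) : ℕ∞)) →
      ∀ σ : S, rc σ ≤ ((p * r (θ.symm σ) + p - 1 : ℕ) : ℕ∞)) := by
  have hlower : ∀ σ : S, (p : ℕ∞) * rct (θ.symm σ) ≤ rc σ := by
    intro σ
    rw [hrc]
    refine le_sInf ?_
    rintro _ ⟨n, rfl, hn⟩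
    have hle : rct (θ.symm σ) ≤ ((n / p : ℕ) : ℕ∞) := by
      rw [hrct]
      refine sInf_le ⟨n / p, rfl, fun h => hn ?_⟩
      have := h (n % p) (Nat.mod_lt _ hp)
      rwa [apply_iterate_of_chained_conj hg, Equiv.apply_symm_apply,
        ← Function.iterate_add_apply, Nat.mod_add_div] at this
    calc (p : ℕ∞) * rct (θ.symm σ) ≤ (p : ℕ∞) * ((n / p : ℕ) : ℕ∞) := by gcongr
      _ ≤ (n : ℕ∞) := by exact_mod_cast Nat.mul_div_le n p
  have hp0 : (p : ℕ∞) ≠ 0 := by exact_mod_cast (Nat.one_le_iff_ne_zero.mp hp)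
  have hupper : ∀ σ : S, rc σ ≤ (p : ℕ∞) * rct (θ.symm σ) + ((p - 1 : ℕ) : ℕ∞) := by
    intro σ
    rcases Set.eq_empty_or_nonempty {N : ℕ∞ | ∃ k : ℕ, N = (k : ℕ∞) ∧
      ¬ (∀ i < p, φ (f^[i] (θ (g^[k] (θ.symm σ)))))} with he | hne
    · rw [hrct, he, sInf_empty, ENat.mul_top hp0, top_add]
      exact le_top
    · obtain ⟨k, hk, hnot⟩ := csInf_mem hne
      rw [← hrct] at hk
      push Not at hnot
      obtain ⟨i, hi, hφ⟩ := hnot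
      rw [apply_iterate_of_chained_conj hg, Equiv.apply_symm_apply,
        ← Function.iterate_add_apply] at hφ
      have hle : rc σ ≤ ((i + p * k : ℕ) : ℕ∞) := by
        rw [hrc]
        exact sInf_le ⟨_, rfl, hφ⟩
      refine hle.trans ?_
      rw [hk]
      exact_mod_cast (by omega : i + p * k ≤ p * k + (p - 1))
  refine ⟨fun σ => ⟨hlower σ, hupper σ, fun h => ?_, fun h => ?_⟩, fun r hr σ => ?_⟩
  · by_contra hne
    lift rct (θ.symm σ) to ℕ using hne with m hm
    have := hupper σ
    rw [h, ← hm, top_le_iff] at this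
    exact ENat.natCast_ne_top (p * m + (p - 1)) (by exact_mod_cast this)
  · have := hlower σ
    rwa [h, ENat.mul_top hp0, top_le_iff] at this
  · calc rc σ ≤ (p : ℕ∞) * rct (θ.symm σ) + ((p - 1 : ℕ) : ℕ∞) := hupper σ
      _ ≤ (p : ℕ∞) * (r (θ.symm σ) : ℕ∞) + ((p - 1 : ℕ) : ℕ∞) := by
        gcongr
        exact hr _
      _ = ((p * r (θ.symm σ) + p - 1 : ℕ) : ℕ∞) := by
        rw [Nat.add_sub_assoc hp]
        norm_cast
end

section
/- Bound on the period (Lemma 7). Let n : ℕ, let A : Matrix (Fin n) (Fin n) ℤ, and let λ : ℂ be an eigenvalue of A over ℂ, i.e., a root of the characteristic polynomial of A.map (Int.cast : ℤ → ℂ). If λ is periodic rational, i.e., there exists p : ℕ with p > 0 and some q : ℚ with λ^p = (q : ℂ), then the least such p (the period of λ) satisfies p ≤ n^3. -/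
open Polynomial in
theorem natDegree_minpoly_le_of_isRoot_charpoly {n : ℕ} (A : Matrix (Fin n) (Fin n) ℤ) (lam : ℂ)
    (hlam : ((A.map (Int.cast : ℤ → ℂ)).charpoly).IsRoot lam) :
    IsIntegral ℚ lam ∧ (minpoly ℚ lam).natDegree ≤ n := by
  have hA : (A.map (Int.cast : ℤ → ℂ)) = (A.map (Int.castRingHom ℚ)).map (algebraMap ℚ ℂ) := by
    ext i j
    simp
  have hmonic := Matrix.charpoly_monic (A.map (Int.castRingHom ℚ))
  have hroot : aeval lam (A.map (Int.castRingHom ℚ)).charpoly = 0 := by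
    rw [hA, Matrix.charpoly_map, IsRoot, eval_map_algebraMap] at hlam
    exact hlam
  refine ⟨⟨_, hmonic, hroot⟩, ?_⟩
  have h := natDegree_le_of_dvd (minpoly.dvd ℚ lam hroot) hmonic.ne_zero
  rwa [Matrix.charpoly_natDegree_eq_dim, Fintype.card_fin] at h

theorem Nat.le_totient_sq_of_odd (m : ℕ) (hm : Odd m) : m ≤ m.totient ^ 2 := by
  induction m using Nat.recOnPosPrimePosCoprime with
  | prime_pow p k hp hk =>
    have hp2 : p ≠ 2 := by
      rintro rfl
      exact absurd hm (by simp [Nat.not_odd_iff_even, Nat.even_pow, hk.ne'])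
    have hp3 : 3 ≤ p := by have := hp.two_le; omega
    obtain ⟨k, rfl⟩ : ∃ j, k = j + 1 := ⟨k - 1, by omega⟩
    obtain ⟨a, rfl⟩ : ∃ a, p = a + 1 := ⟨p - 1, by omega⟩
    rw [Nat.totient_prime_pow_succ hp, mul_pow, pow_succ, Nat.add_sub_cancel]
    refine Nat.mul_le_mul (Nat.le_self_pow two_ne_zero _) ?_
    nlinarith
  | zero => simp
  | one => simp
  | coprime a b ha hb hab iha ihb =>
    rw [Nat.odd_mul] at hm
    rw [Nat.totient_mul hab, mul_pow]
    exact Nat.mul_le_mul (iha hm.1) (ihb hm.2)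

theorem Nat.le_two_mul_totient_sq (m : ℕ) : m ≤ 2 * m.totient ^ 2 := by
  rcases Nat.eq_zero_or_pos m with rfl | hm
  · simp
  obtain ⟨k, b, hb, rfl⟩ := Nat.exists_eq_two_pow_mul_odd hm.ne'
  have hodd := Nat.le_totient_sq_of_odd b hb
  rcases k with _ | k
  · simp only [pow_zero, one_mul]
    omega
  · have hc : Nat.Coprime (2 ^ (k + 1)) b := (Nat.coprime_two_left.mpr hb).pow_left _
    rw [Nat.totient_mul hc, Nat.totient_prime_pow_succ Nat.prime_two, mul_pow, pow_succ]
    have h1 : 2 ^ k ≤ (2 ^ k) ^ 2 := Nat.le_self_pow two_ne_zero _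
    calc 2 ^ k * 2 * b ≤ (2 ^ k) ^ 2 * 2 * b.totient ^ 2 := by gcongr
      _ = _ := by ring

/-- Some power `ζ ^ e` of a root of unity, with `0 < e ≤ φ(orderOf ζ) ^ 2`, equals `1` or `-1`. -/
theorem exists_pow_eq_one_or_neg_one {K : Type*} [Field K] (ζ : K) (hζ : 0 < orderOf ζ) :
    ∃ e : ℕ, 0 < e ∧ e ≤ (orderOf ζ).totient ^ 2 ∧ (ζ ^ e = 1 ∨ ζ ^ e = -1) := by
  rcases Nat.even_or_odd' (orderOf ζ) with ⟨e, he | he⟩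
  · have := Nat.le_two_mul_totient_sq (orderOf ζ)
    refine ⟨e, by omega, by omega, ?_⟩
    rw [← sq_eq_one_iff, ← pow_mul, mul_comm, ← he, pow_orderOf_eq_one]
  · exact ⟨orderOf ζ, hζ, Nat.le_totient_sq_of_odd _ ⟨e, he⟩, .inl (pow_orderOf_eq_one ζ)⟩

theorem totient_orderOf_le_finrank {K : Type*} [Field K] [Algebra ℚ K] [FiniteDimensional ℚ K]
    (ζ : K) (hζ : 0 < orderOf ζ) : (orderOf ζ).totient ≤ Module.finrank ℚ K := by
  have : CharZero K := algebraRat.charZero K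
  have hprim := IsPrimitiveRoot.orderOf ζ
  rw [← Polynomial.natDegree_cyclotomic (orderOf ζ) ℚ,
    Polynomial.cyclotomic_eq_minpoly_rat hprim hζ,
    Subsingleton.elim DivisionRing.toRatAlgebra ‹Algebra ℚ K›]
  exact minpoly.natDegree_le ζ

/-- If a nonzero element of a number field of degree `d` has some positive power rational, then it
has one with exponent at most `d ^ 3`. -/
theorem exists_pow_rational_le_finrank_cube {K : Type*} [Field K] [Algebra ℚ K]
    [FiniteDimensional ℚ K] {x : K} (hx : x ≠ 0) {p : ℕ} (hp : 0 < p) {q : ℚ}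
    (hq : x ^ p = algebraMap ℚ K q) :
    ∃ k : ℕ, 0 < k ∧ k ≤ Module.finrank ℚ K ^ 3 ∧ ∃ r : ℚ, x ^ k = algebraMap ℚ K r := by
  set d := Module.finrank ℚ K with hd
  have hdpos : 0 < d := Module.finrank_pos
  set c := Algebra.norm ℚ x
  have hc : algebraMap ℚ K c ≠ 0 :=
    (map_ne_zero _).mpr (Algebra.norm_ne_zero_iff.mpr hx)
  have hcp : c ^ p = q ^ d := by
    rw [← map_pow, hq, Algebra.norm_algebraMap]
  set ζ : K := x ^ d / algebraMap ℚ K c with hζdef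
  have hζp : ζ ^ p = 1 := by
    rw [hζdef, div_pow, ← pow_mul, mul_comm, pow_mul, hq, ← map_pow, ← map_pow, hcp]
    exact div_self (by rw [← hcp, map_pow]; exact pow_ne_zero _ hc)
  have hord : 0 < orderOf ζ := orderOf_pos_iff.mpr (isOfFinOrder_iff_pow_eq_one.mpr ⟨p, hp, hζp⟩)
  obtain ⟨e, he, hle, h⟩ := exists_pow_eq_one_or_neg_one ζ hord
  have hxe : x ^ (d * e) = ζ ^ e * algebraMap ℚ K c ^ e := by
    rw [pow_mul, ← mul_pow, hζdef, div_mul_cancel₀ _ hc]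
  refine ⟨d * e, Nat.mul_pos hdpos he, ?_, ?_⟩
  · calc d * e ≤ d * d ^ 2 := by
          gcongr
          exact hle.trans (Nat.pow_le_pow_left (totient_orderOf_le_finrank ζ hord) 2)
      _ = d ^ 3 := by ring
  · rcases h with h | h
    · exact ⟨c ^ e, by rw [hxe, h, one_mul, map_pow]⟩
    · exact ⟨-c ^ e, by rw [hxe, h, neg_one_mul, map_neg, map_pow]⟩

/-- Lemma 7: if an eigenvalue `lam` of an `n × n` integer matrix is periodic
rational, then its period (the least `p > 0` with `lam ^ p` rational) is at
most `n ^ 3`. -/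
theorem period_bound
    {n : ℕ} (A : Matrix (Fin n) (Fin n) ℤ) (lam : ℂ)
    (hlam : ((A.map (Int.cast : ℤ → ℂ)).charpoly).IsRoot lam)
    (hper : ∃ p : ℕ, 0 < p ∧ ∃ q : ℚ, lam ^ p = (q : ℂ)) :
    sInf {p : ℕ | 0 < p ∧ ∃ q : ℚ, lam ^ p = (q : ℂ)} ≤ n ^ 3 := by
  obtain ⟨hint, hdeg⟩ := natDegree_minpoly_le_of_isRoot_charpoly A lam hlam
  suffices h : ∃ k : ℕ, 0 < k ∧ k ≤ (minpoly ℚ lam).natDegree ^ 3 ∧ ∃ r : ℚ, lam ^ k = (r : ℂ) by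
    obtain ⟨k, hk, hle, hr⟩ := h
    have hmem : k ∈ {p : ℕ | 0 < p ∧ ∃ q : ℚ, lam ^ p = (q : ℂ)} := ⟨hk, hr⟩
    exact (Nat.sInf_le hmem).trans (hle.trans (Nat.pow_le_pow_left hdeg 3))
  rcases eq_or_ne lam 0 with rfl | h0
  · exact ⟨1, one_pos, Nat.one_le_pow _ _ (minpoly.natDegree_pos hint), 0, by simp⟩
  obtain ⟨p, hp, q, hq⟩ := hper
  have : FiniteDimensional ℚ (IntermediateField.adjoin ℚ {lam}) :=
    IntermediateField.adjoin.finiteDimensional hint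
  have hgen := IntermediateField.AdjoinSimple.coe_gen ℚ lam
  have hx : IntermediateField.AdjoinSimple.gen ℚ lam ≠ 0 := by
    intro h
    rw [h] at hgen
    exact h0 hgen.symm
  obtain ⟨k, hk, hle, r, hr⟩ := exists_pow_rational_le_finrank_cube (q := q) hx hp
    (Subtype.ext (by simpa using hq))
  rw [IntermediateField.adjoin.finrank hint] at hle
  exact ⟨k, hk, hle, r, by simpa using congrArg Subtype.val hr⟩
end

section
/- Lifting local size bounds (Theorem 17). Fix an integer program (V, L, ℓ₀, T). Let T' be a nonempty subset of T \ T₀, let t' ∈ T', let S : V → ((V → ℕ) → ℕ) be a local size bound for t' with respect to T' such that for each x ∈ V the function S x is weakly monotonically increasing (with respect to the pointwise order on V → ℕ), and let SB : T → V → ((V → ℕ) → ℕ) be a size bound for the program. Define SB' by SB' t' x ν = Σ_{r ∈ E_{T'}} S x (fun v => SB r v ν) and SB' t x = SB t x for every t ≠ t'. Then SB' is also a size bound for the program. -/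
/-- An integer program over variables `V`, locations `L`, and (finitely many)
transitions named by `ι`.  Each transition `t` has a source, a target (which is
never the initial location), a guard, and an update. -/
structure IntProg (V L ι : Type*) where
  init : L
  src : ι → L
  tgt : ι → L
  grd : ι → (V → ℤ) → Prop
  upd : ι → (V → ℤ) → (V → ℤ)
  tgt_ne_init : ∀ t, tgt t ≠ init

namespace IntProg

variable {V L ι : Type*}

/-- Evaluation step with transition `t`. -/
def Step (P : IntProg V L ι) (t : ι) (c c' : L × (V → ℤ)) : Prop :=
  c.1 = P.src t ∧ c'.1 = P.tgt t ∧ P.grd t c.2 ∧ c'.2 = P.upd t c.2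

/-- Evaluation step with some transition from `U`. -/
def StepIn (P : IntProg V L ι) (U : Set ι) (c c' : L × (V → ℤ)) : Prop :=
  ∃ t ∈ U, P.Step t c c'

open Classical in
/-- The entry transitions `E_{T'}` of a set of transitions `T'`. -/
noncomputable def entry [Fintype ι] (P : IntProg V L ι) (T' : Finset ι) : Finset ι :=
  Finset.univ.filter fun r => r ∉ T' ∧ ∃ t ∈ T', P.tgt r = P.src t

/-- A (global) size bound for the program: `SB t x |σ₀|` bounds `|σ' x|`
whenever a run from the initial configuration `(ℓ₀, σ₀)` takes transition `t`
and ends in the state `σ'`. -/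
def IsSizeBound [Fintype ι] (P : IntProg V L ι) (SB : ι → V → ((V → ℕ) → ℕ)) : Prop :=
  ∀ (t : ι) (x : V) (σ₀ : V → ℤ) (c c' : L × (V → ℤ)),
    Relation.ReflTransGen (P.StepIn Set.univ) (P.init, σ₀) c →
    P.Step t c c' →
    (c'.2 x).natAbs ≤ SB t x (fun v => (σ₀ v).natAbs)

/-- A local size bound for `t'` w.r.t. the subprogram `T'`: it bounds the
values after runs through `T'` that start after an entry transition of `T'`
and end with an evaluation of `t'`. -/
def IsLocalSizeBound [Fintype ι] (P : IntProg V L ι) (T' : Finset ι) (t' : ι)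
    (S : V → ((V → ℕ) → ℕ)) : Prop :=
  ∀ (x : V) (r : ι), r ∈ P.entry T' →
    ∀ (σ : V → ℤ) (c c' : L × (V → ℤ)),
      Relation.ReflTransGen (P.StepIn (↑T' : Set ι)) (P.tgt r, σ) c →
      P.Step t' c c' →
      (c'.2 x).natAbs ≤ S x (fun v => (σ v).natAbs)

end IntProg

namespace IntProg

/-- A run from an initial configuration to a source location of `T'` factors through an entry
transition of `T'` followed by a run inside `T'`. -/
theorem exists_entry_step_of_run {V L ι : Type*} [Fintype ι] (P : IntProg V L ι)
    {T' : Finset ι} (hT' : ∀ t ∈ T', P.src t ≠ P.init) {σ₀ : V → ℤ} {c : L × (V → ℤ)}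
    (hrun : Relation.ReflTransGen (P.StepIn Set.univ) (P.init, σ₀) c)
    (hc : ∃ t ∈ T', c.1 = P.src t) :
    ∃ r ∈ P.entry T', ∃ d e : L × (V → ℤ),
      Relation.ReflTransGen (P.StepIn Set.univ) (P.init, σ₀) d ∧ P.Step r d e ∧
        Relation.ReflTransGen (P.StepIn (↑T' : Set ι)) e c := by
  induction hrun with
  | refl =>
    obtain ⟨t, ht, h⟩ := hc
    exact absurd h.symm (hT' t ht)
  | @tail b c hab hbc ih =>
    obtain ⟨t₀, -, hstep⟩ := hbc
    by_cases h₀ : t₀ ∈ T'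
    · obtain ⟨r, hr, d, e, hd, hde, hrest⟩ := ih ⟨t₀, h₀, hstep.1⟩
      exact ⟨r, hr, d, e, hd, hde, hrest.tail ⟨t₀, h₀, hstep⟩⟩
    · obtain ⟨t, ht, h⟩ := hc
      refine ⟨t₀, ?_, b, c, hab, hstep, .refl⟩
      simp only [entry, Finset.mem_filter, Finset.mem_univ, true_and]
      exact ⟨h₀, t, ht, hstep.2.1.symm.trans h⟩

end IntProg

/-- Theorem 17: lifting local size bounds to global size bounds. -/
theorem lifting_local_size_bounds
    {V L ι : Type*} [Fintype ι]
    (P : IntProg V L ι)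
    (T' : Finset ι) (hT'ne : T'.Nonempty)
    (hT'0 : ∀ t ∈ T', P.src t ≠ P.init)
    (t' : ι) (ht' : t' ∈ T')
    (S : V → ((V → ℕ) → ℕ))
    (hSmono : ∀ x : V, Monotone (S x))
    (hS : P.IsLocalSizeBound T' t' S)
    (SB : ι → V → ((V → ℕ) → ℕ))
    (hSB : P.IsSizeBound SB)
    (SB' : ι → V → ((V → ℕ) → ℕ))
    (hSB't' : ∀ (x : V) (ν : V → ℕ),
      SB' t' x ν = ∑ r ∈ P.entry T', S x (fun v => SB r v ν))
    (hSB'other : ∀ t : ι, t ≠ t' → ∀ x : V, SB' t x = SB t x) :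
    P.IsSizeBound SB' := by
  intro t x σ₀ c c' hrun hstep
  by_cases ht : t = t'
  · subst ht
    obtain ⟨r, hr, d, ⟨l, σ⟩, hd, hde, hrest⟩ :=
      P.exists_entry_step_of_run hT'0 hrun ⟨t, ht', hstep.1⟩
    obtain rfl : l = P.tgt r := hde.2.1
    rw [hSB't']
    calc (c'.2 x).natAbs ≤ S x (fun v => (σ v).natAbs) := hS x r hr σ c c' hrest hstep
      _ ≤ S x (fun v => SB r v (fun v => (σ₀ v).natAbs)) :=
        hSmono x fun v => hSB r v σ₀ d _ hd hde
      _ ≤ ∑ r ∈ P.entry T', S x (fun v => SB r v (fun v => (σ₀ v).natAbs)) :=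
        Finset.single_le_sum (f := fun r => S x (fun v => SB r v (fun v => (σ₀ v).natAbs)))
          (fun _ _ => Nat.zero_le _) hr
  · rw [hSB'other t ht x]
    exact hSB t x σ₀ c c' hrun hstep
end

section
/- Local size bounds via loops (Lemma 18). Fix a finite type V of variables with states Σ = V → ℤ. Let t_L be a self-loop transition at location ℓ (src t_L = tgt t_L = ℓ) with guard grd and update upd, let (φ_L, f_L) be a semantic loop on states Fin d → ℤ with runtime complexity rc_L, let V' : Set V, and let π : Fin d ≃ V' be a variable renaming such that t_L corresponds to the loop via π: for all σ : Σ, grd σ ↔ φ_L (fun i => σ (π i)), and (upd σ) v = f_L (fun i => σ (π i)) (π.symm ⟨v, h⟩) if h : v ∈ V', and (upd σ) v = σ v if v ∉ V'. Let SB_L : Fin d → ((Fin d → ℕ) → ℕ) be a size bound for the loop, i.e., for all i : Fin d, τ : Fin d → ℤ, and n : ℕ with (n : ℕ∞) ≤ rc_L τ, SB_L i (fun j => (τ j).natAbs) ≥ ((f_L^[n] τ) i).natAbs. Then π ∘ SB_L ∘ π.symm is a local size bound for t_L with respect to {t_L}: for every x ∈ V' (say x = π i), every σ : Σ, and every run (ℓ,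 σ) →_{t_L}^* (ℓ, σ'') →_{t_L} (ℓ, σ'), one has SB_L i (fun j => (σ (π j)).natAbs) ≥ (σ' x).natAbs. -/
/-- Lemma 18: local size bounds via loops.  If a self-loop transition `t_L` at
location `ℓ` corresponds (via the variable renaming `π`) to a semantic loop
`(φL, fL)` with runtime complexity `rcL`, and `SBL` is a size bound for the
loop, then `π ∘ SBL ∘ π.symm` is a local size bound for `t_L` w.r.t. `{t_L}`. -/
theorem local_size_bounds_via_loops
    {V : Type*} [Fintype V] {L : Type*} (ℓ : L) {d : ℕ}
    (grd : (V → ℤ) → Prop) (upd : (V → ℤ) → (V → ℤ))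
    (φL : (Fin d → ℤ) → Prop) (fL : (Fin d → ℤ) → (Fin d → ℤ))
    (rcL : (Fin d → ℤ) → ℕ∞)
    (hrcL : ∀ τ : Fin d → ℤ,
      rcL τ = sInf {N : ℕ∞ | ∃ n : ℕ, N = (n : ℕ∞) ∧ ¬ φL (fL^[n] τ)})
    (V' : Set V) (π : Fin d ≃ V')
    (hgrd : ∀ σ : V → ℤ, grd σ ↔ φL (fun i => σ (π i)))
    (hupd_in : ∀ (σ : V → ℤ) (v : V) (h : v ∈ V'),
      upd σ v = fL (fun i => σ (π i)) (π.symm ⟨v, h⟩))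
    (hupd_out : ∀ (σ : V → ℤ) (v : V), v ∉ V' → upd σ v = σ v)
    (SBL : Fin d → ((Fin d → ℕ) → ℕ))
    (hSBL : ∀ (i : Fin d) (τ : Fin d → ℤ) (n : ℕ), (n : ℕ∞) ≤ rcL τ →
      ((fL^[n] τ) i).natAbs ≤ SBL i (fun j => (τ j).natAbs)) :
    ∀ (i : Fin d) (σ : V → ℤ) (c c' : L × (V → ℤ)),
      Relation.ReflTransGen
        (fun a b : L × (V → ℤ) => a.1 = ℓ ∧ b.1 = ℓ ∧ grd a.2 ∧ b.2 = upd a.2)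
        (ℓ, σ) c →
      (c.1 = ℓ ∧ c'.1 = ℓ ∧ grd c.2 ∧ c'.2 = upd c.2) →
      (c'.2 (π i)).natAbs ≤ SBL i (fun j => (σ (π j)).natAbs) := by
  intro i σ c c' hrun hstep
  have hupd (ρ : V → ℤ) : (fun j => upd ρ (π j)) = fL (fun j => ρ (π j)) := by
    funext j
    simp [hupd_in ρ (π j) (π j).2]
  have orbit : ∀ b, Relation.ReflTransGen
      (fun a b : L × (V → ℤ) => a.1 = ℓ ∧ b.1 = ℓ ∧ grd a.2 ∧ b.2 = upd a.2) (ℓ, σ) b →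
      ∃ n : ℕ, (fun j => b.2 (π j)) = fL^[n] (fun j => σ (π j)) ∧
        ∀ m < n, φL (fL^[m] (fun j => σ (π j))) := by
    intro b hb
    induction hb with
    | refl => exact ⟨0, rfl, by simp⟩
    | tail _ h ih =>
      obtain ⟨n, hn, hφ⟩ := ih
      obtain ⟨-, -, hg, hu⟩ := h
      refine ⟨n + 1, ?_, fun m hm => ?_⟩
      · rw [hu, hupd, hn, Function.iterate_succ_apply']
      · rcases Nat.lt_succ_iff_lt_or_eq.mp hm with hlt | rfl
        · exact hφ m hlt
        · exact hn ▸ (hgrd _).mp hg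
  obtain ⟨n, hn, hφ⟩ := orbit c' (hrun.tail hstep)
  have hle : (n : ℕ∞) ≤ rcL (fun j => σ (π j)) := by
    rw [hrcL]
    refine le_sInf ?_
    rintro _ ⟨m, rfl, hm⟩
    exact_mod_cast not_lt.mp fun h => hm (hφ m h)
  rw [show c'.2 (π i) = (fL^[n] fun j => σ (π j)) i from congrFun hn i]
  exact hSBL i _ n hle
end

section
/- Local size bounds for simple cycles (Theorem 21). Fix an integer program (V, L, ℓ₀, T) and a simple cycle C = {t₁, …, t_n} ⊆ T \ T₀: there are pairwise distinct locations ℓ₁, …, ℓ_n with src t_i = ℓ_i for all i, tgt t_i = ℓ_{i+1} for 1 ≤ i ≤ n−1, and tgt t_n = ℓ₁. Write φ_i = grd t_i and f_i = upd t_i. Let the chained loop of C be the semantic loop on Σ with guard Ψ σ := φ₁ σ ∧ φ₂ (f₁ σ) ∧ … ∧ φ_n ((f_{n−1} ∘ … ∘ f₁) σ) and update g := f_n ∘ … ∘ f₁, with runtime complexity rc_L σ = sInf {(k : ℕ∞) | k : ℕ, ¬ Ψ (g^[k] σ)}. Let SB_L : V → ((V → ℕ) → ℕ) be a size bound for this loop,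 i.e., for all x ∈ V, σ : Σ, and k : ℕ with (k : ℕ∞) ≤ rc_L σ, SB_L x |σ| ≥ |(g^[k] σ) x|. For each i ∈ {1, …, n}, let B_i : V → ((V → ℕ) → ℕ) satisfy B_i x |σ| ≥ SB_L x |(f_n ∘ f_{n−1} ∘ … ∘ f_i) σ| for all x ∈ V and σ : Σ. Then S defined by S x ν := Σ_{i ∈ {1,…,n}, ∃ r ∈ E_C, tgt r = ℓ_i} B_i x ν is a local size bound for t_n with respect to C: for every x ∈ V, every r ∈ E_C, every σ : Σ, and every run (tgt r, σ) →_C^* (ℓ'', σ'') →_{t_n} (ℓ₁, σ'), one has S x |σ| ≥ |σ' x|. -/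
/-- A natural number is at most the least index violating `p` as soon as `p` holds strictly
below it. -/
theorem natCast_le_sInf_not {p : ℕ → Prop} {m : ℕ} (h : ∀ k < m, p k) :
    (m : ℕ∞) ≤ sInf {N : ℕ∞ | ∃ k : ℕ, N = (k : ℕ∞) ∧ ¬ p k} := by
  refine le_sInf ?_
  rintro _ ⟨k, rfl, hk⟩
  exact Nat.cast_le.2 (not_lt.1 fun hkm => hk (h k hkm))

open Classical in
/-- Theorem 21: local size bounds for simple cycles.  The simple cycle
`C = {ts 0, …, ts (Fin.last n)}` visits the pairwise distinct locations
`ℓs 0, …, ℓs (Fin.last n)` cyclically.  `pre i` is the composition of the first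
`i` updates of the cycle (so `pre (Fin.last (n+1))` is the update `g` of the
chained loop), `suf i` is the composition `f_n ∘ … ∘ f_i` of the updates from
position `i` to the end of the cycle, `rcL` is the runtime complexity of the
chained loop, and `SBL` is a size bound for the chained loop.  Then summing the
bounds `B i` (which over-approximate `SBL` precomposed with `suf i`) over all
positions `i` at which an entry transition enters the cycle gives a local size
bound for the last transition `ts (Fin.last n)` w.r.t. `C`. -/
theorem local_size_bounds_for_simple_cycles
    {V L ι : Type*} [Fintype V] (P : IntProg V L ι) (n : ℕ)
    (ts : Fin (n + 1) → ι) (ℓs : Fin (n + 1) → L)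
    (hdist : Function.Injective ℓs)
    (hC0 : ∀ i : Fin (n + 1), P.src (ts i) ≠ P.init)
    (hsrc : ∀ i : Fin (n + 1), P.src (ts i) = ℓs i)
    (htgt : ∀ i : Fin (n + 1), P.tgt (ts i) = ℓs (i + 1))
    (pre : Fin (n + 2) → (V → ℤ) → (V → ℤ))
    (hpre0 : ∀ σ : V → ℤ, pre 0 σ = σ)
    (hpreS : ∀ (i : Fin (n + 1)) (σ : V → ℤ),
      pre i.succ σ = P.upd (ts i) (pre i.castSucc σ))
    (rcL : (V → ℤ) → ℕ∞)
    (hrcL : ∀ σ : V → ℤ, rcL σ =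
      sInf {N : ℕ∞ | ∃ k : ℕ, N = (k : ℕ∞) ∧
        ¬ (∀ i : Fin (n + 1),
            P.grd (ts i) (pre i.castSucc ((pre (Fin.last (n + 1)))^[k] σ)))})
    (SBL : V → ((V → ℕ) → ℕ))
    (hSBL : ∀ (x : V) (σ : V → ℤ) (k : ℕ), (k : ℕ∞) ≤ rcL σ →
      (((pre (Fin.last (n + 1)))^[k] σ) x).natAbs ≤ SBL x (fun v => (σ v).natAbs))
    (suf : Fin (n + 1) → (V → ℤ) → (V → ℤ))
    (hsuf_last : ∀ σ : V → ℤ, suf (Fin.last n) σ = P.upd (ts (Fin.last n)) σ)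
    (hsuf_step : ∀ (i : Fin n) (σ : V → ℤ),
      suf i.castSucc σ = suf i.succ (P.upd (ts i.castSucc) σ))
    (B : Fin (n + 1) → V → ((V → ℕ) → ℕ))
    (hB : ∀ (i : Fin (n + 1)) (x : V) (σ : V → ℤ),
      SBL x (fun v => ((suf i σ) v).natAbs) ≤ B i x (fun v => (σ v).natAbs)) :
    ∀ (x : V) (r : ι),
      (r ∉ Set.range ts ∧ ∃ j : Fin (n + 1), P.tgt r = P.src (ts j)) →
      ∀ (σ : V → ℤ) (c c' : L × (V → ℤ)),
        Relation.ReflTransGen (P.StepIn (Set.range ts)) (P.tgt r, σ) c →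
        P.Step (ts (Fin.last n)) c c' →
        (c'.2 x).natAbs ≤
          ∑ i ∈ Finset.univ.filter (fun i : Fin (n + 1) =>
              ∃ r' : ι, (r' ∉ Set.range ts ∧ ∃ j : Fin (n + 1),
                P.tgt r' = P.src (ts j)) ∧ P.tgt r' = ℓs i),
            B i x (fun v => (σ v).natAbs) := by
  intro x r ⟨hr, j, hj⟩ σ c c' hrun hstep
  set g := pre (Fin.last (n + 1))
  set τ := suf j σ
  let Ψ : (V → ℤ) → Prop := fun ρ => ∀ i, P.grd (ts i) (pre i.castSucc ρ)
  -- Either the first partial round is still running, or it ended in `τ` and the chained loop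
  -- has completed `k` full rounds from there.
  let Inv : L × (V → ℤ) → Prop := fun d =>
    (∃ i, d.1 = ℓs i ∧ suf i d.2 = τ) ∨
    ∃ (i : Fin (n + 1)) (k : ℕ), d.1 = ℓs i ∧ d.2 = pre i.castSucc (g^[k] τ) ∧
      (∀ m < k, Ψ (g^[m] τ)) ∧ ∀ i' < i, P.grd (ts i') (pre i'.castSucc (g^[k] τ))
  have idx_eq : ∀ {d d' : L × (V → ℤ)} {i i' : Fin (n + 1)}, P.Step (ts i') d d' →
      d.1 = ℓs i → i' = i := fun h hd =>
    hdist ((hsrc _).symm.trans (h.1.symm.trans hd))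
  have last_step : ∀ d d', Inv d → P.Step (ts (Fin.last n)) d d' →
      ∃ k : ℕ, d'.2 = g^[k] τ ∧ ∀ m < k, Ψ (g^[m] τ) := by
    rintro d d' (⟨i, hd, hs⟩ | ⟨i, k, hd, hs, hΨ, hi⟩) h
    · obtain rfl := idx_eq h hd
      exact ⟨0, by rw [h.2.2.2, ← hsuf_last, hs]; rfl, by simp⟩
    · obtain rfl := idx_eq h hd
      refine ⟨k + 1, ?_, fun m hm => ?_⟩
      · rw [h.2.2.2, hs, ← hpreS, Fin.succ_last, Function.iterate_succ_apply']
      · rcases Nat.lt_succ_iff_lt_or_eq.1 hm with hm | rfl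
        · exact hΨ m hm
        · intro i'
          rcases (Fin.le_last i').lt_or_eq with hi' | rfl
          · exact hi i' hi'
          · exact hs ▸ h.2.2.1
  have inv_step : ∀ d d', Inv d → P.StepIn (Set.range ts) d d' → Inv d' := by
    rintro d d' hd ⟨_, ⟨i, rfl⟩, h⟩
    have htgt' := h.2.1.trans (htgt i)
    induction i using Fin.lastCases with
    | last =>
      obtain ⟨k, hk, hΨ⟩ := last_step d d' hd h
      rw [Fin.last_add_one] at htgt'
      exact Or.inr ⟨0, k, htgt', by rw [hk, Fin.castSucc_zero, hpre0], hΨ,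
        fun i' hi' => absurd hi' (Fin.not_lt_zero i')⟩
    | cast i =>
      rw [Fin.coeSucc_eq_succ] at htgt'
      rcases hd with ⟨i', hd, hs⟩ | ⟨i', k, hd, hs, hΨ, hi⟩
      · obtain rfl := idx_eq h hd
        exact Or.inl ⟨i.succ, htgt', by rw [h.2.2.2, ← hsuf_step, hs]⟩
      · obtain rfl := idx_eq h hd
        refine Or.inr ⟨i.succ, k, htgt', ?_, hΨ, fun i' hi' => ?_⟩
        · rw [h.2.2.2, hs, ← hpreS, Fin.succ_castSucc]
        · rcases (Fin.le_castSucc_iff.2 hi').lt_or_eq with hi' | rfl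
          · exact hi i' hi'
          · exact hs ▸ h.2.2.1
  have hj' : P.tgt r = ℓs j := hj.trans (hsrc j)
  have inv_c : Inv c := by
    clear hstep
    induction hrun with
    | refl => exact Or.inl ⟨j, hj', rfl⟩
    | tail _ h ih => exact inv_step _ _ ih h
  obtain ⟨k, hk, hΨ⟩ := last_step c c' inv_c hstep
  rw [hk]
  calc _ ≤ SBL x (fun v => (τ v).natAbs) :=
        hSBL x τ k (by rw [hrcL]; exact natCast_le_sInf_not hΨ)
    _ ≤ B j x (fun v => (σ v).natAbs) := hB j x σ
    _ ≤ _ := Finset.single_le_sum (f := fun i => B i x (fun v => (σ v).natAbs))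
        (fun _ _ => Nat.zero_le _)
        (Finset.mem_filter.2 ⟨Finset.mem_univ j, r, ⟨hr, j, hj⟩, hj'⟩)
end

section
/- Summation kernel for unit closed forms (claim in the proof of Theorem 13). Let a : ℕ and c, b : ℂ with ‖c‖ ≤ 1 and ‖b‖ ≤ 1. Then the function F : ℕ → ℂ, F n = Σ_{i=1}^{n} c^(n−i) * ((i − 1 : ℕ) : ℂ)^a * b^(i−1), is eventually unit poly-exponential: there exist n₀ : ℕ, k : ℕ, α : Fin k → ℂ, a' : Fin k → ℕ, and b' : Fin k → ℂ with ‖b' j‖ ≤ 1 for all j, such that F n = Σ_j (α j) * (n : ℂ)^(a' j) * (b' j)^n for all n ≥ n₀. -/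
open Polynomial in
/-- The operator `P ↦ b P(X + 1) - c P` hits every monomial unless `b = c = 0`. -/
theorem exists_polynomial_twisted_difference (b c : ℂ) (h : b ≠ c ∨ b ≠ 0) (a : ℕ) :
    ∃ P : ℂ[X], ∀ x : ℂ, b * P.eval (x + 1) - c * P.eval x = x ^ a := by
  induction a using Nat.strong_induction_on with
  | _ a ih =>
    choose! P hP using ih
    have sum_eq (r : ℕ → ℂ) (x : ℂ) :
        b * ∑ j ∈ Finset.range a, r j * (P j).eval (x + 1)
          - c * ∑ j ∈ Finset.range a, r j * (P j).eval x
          = ∑ j ∈ Finset.range a, r j * x ^ j := by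
      rw [Finset.mul_sum, Finset.mul_sum, ← Finset.sum_sub_distrib]
      refine Finset.sum_congr rfl fun j hj => ?_
      rw [← hP j (Finset.mem_range.mp hj) x]
      ring
    have binomial (m : ℕ) (x : ℂ) :
        (x + 1) ^ m = ∑ j ∈ Finset.range (m + 1), (m.choose j : ℂ) * x ^ j := by
      rw [add_pow]
      exact Finset.sum_congr rfl fun j _ => by rw [one_pow]; ring
    by_cases hbc : b = c
    · subst hbc
      have hb : b ≠ 0 := by simpa using h
      have ha : (a : ℂ) + 1 ≠ 0 := Nat.cast_add_one_ne_zero a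
      refine ⟨C (1 / (b * (a + 1))) * (X ^ (a + 1)
        - C b * ∑ j ∈ Finset.range a, C ((a + 1).choose j : ℂ) * P j), fun x => ?_⟩
      have hs := sum_eq (fun j => ((a + 1).choose j : ℂ)) x
      have hx := binomial (a + 1) x
      rw [Finset.sum_range_succ, Finset.sum_range_succ, Nat.choose_self,
        Nat.choose_succ_self_right] at hx
      push_cast at hx
      simp only [eval_mul, eval_sub, eval_C, eval_pow, eval_X, eval_finsetSum]
      field_simp
      linear_combination hx - hs
    · have hd : b - c ≠ 0 := sub_ne_zero.mpr hbc
      refine ⟨C (1 / (b - c)) * (X ^ a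
        - C b * ∑ j ∈ Finset.range a, C (a.choose j : ℂ) * P j), fun x => ?_⟩
      have hs := sum_eq (fun j => (a.choose j : ℂ)) x
      have hx := binomial a x
      rw [Finset.sum_range_succ, Nat.choose_self] at hx
      push_cast at hx
      simp only [eval_mul, eval_sub, eval_C, eval_pow, eval_X, eval_finsetSum]
      field_simp
      linear_combination b * hx - b * hs

/-- The summation kernel solves the recurrence `F (n + 1) = c F n + n ^ a b ^ n`. -/
theorem summation_kernel_succ (a : ℕ) (c b : ℂ) (n : ℕ) :
    (∑ i ∈ Finset.Icc 1 (n + 1),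
        c ^ (n + 1 - i) * ((i - 1 : ℕ) : ℂ) ^ a * b ^ (i - 1)) =
      c * (∑ i ∈ Finset.Icc 1 n, c ^ (n - i) * ((i - 1 : ℕ) : ℂ) ^ a * b ^ (i - 1))
        + (n : ℂ) ^ a * b ^ n := by
  rw [Finset.sum_Icc_succ_top (by omega), Finset.mul_sum]
  congr 1
  · refine Finset.sum_congr rfl fun i hi => ?_
    rw [Nat.succ_sub (Finset.mem_Icc.mp hi).2, pow_succ]
    ring
  · simp


/-- Claim in the proof of Theorem 13: the summation kernel
`F n = Σ_{i=1}^{n} c^(n−i) · (i−1)^a · b^(i−1)` with `‖c‖ ≤ 1` and `‖b‖ ≤ 1`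
is eventually unit poly-exponential. -/
theorem summation_kernel_unit_polyExp
    (a : ℕ) (c b : ℂ) (hc : ‖c‖ ≤ 1) (hb : ‖b‖ ≤ 1) :
    ∃ (n₀ k : ℕ) (α : Fin k → ℂ) (a' : Fin k → ℕ) (b' : Fin k → ℂ),
      (∀ j, ‖b' j‖ ≤ 1) ∧
      ∀ n : ℕ, n₀ ≤ n →
        (∑ i ∈ Finset.Icc 1 n, c ^ (n - i) * ((i - 1 : ℕ) : ℂ) ^ a * b ^ (i - 1)) =
          ∑ j, α j * (n : ℂ) ^ (a' j) * (b' j) ^ n := by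
  by_cases h : b ≠ c ∨ b ≠ 0
  · obtain ⟨P, hP⟩ := exists_polynomial_twisted_difference b c h a
    refine ⟨0, P.natDegree + 1 + 1, Fin.cons (-P.eval 0) fun i => P.coeff i,
      Fin.cons 0 fun i => i, Fin.cons c fun _ => b, ?_, fun n _ => ?_⟩
    · intro j
      refine Fin.cases ?_ (fun i => ?_) j
      · simpa using hc
      · simpa using hb
    · have closed_form : (∑ i ∈ Finset.Icc 1 n,
          c ^ (n - i) * ((i - 1 : ℕ) : ℂ) ^ a * b ^ (i - 1)) =
          P.eval (n : ℂ) * b ^ n - P.eval 0 * c ^ n := by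
        induction n with
        | zero => simp
        | succ n ih =>
          rw [summation_kernel_succ, ih (Nat.zero_le n), ← hP n]
          push_cast
          ring
      rw [closed_form, Fin.sum_univ_succ, Polynomial.eval_eq_sum_range,
        ← Fin.sum_univ_eq_sum_range (fun i => P.coeff i * (n : ℂ) ^ i), Finset.sum_mul]
      simp only [Fin.cons_zero, Fin.cons_succ]
      ring
  · push Not at h
    obtain ⟨hbc, rfl⟩ := h
    subst hbc
    refine ⟨2, 0, Fin.elim0, Fin.elim0, Fin.elim0, fun j => j.elim0, fun n hn => ?_⟩
    rw [Fin.sum_univ_zero]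
    refine Finset.sum_eq_zero fun i _ => ?_
    by_cases hi : i - 1 = 0
    · rw [zero_pow (by omega : n - i ≠ 0), zero_mul, zero_mul]
    · rw [zero_pow hi, mul_zero]
end
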